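/- arXiv:math/9809068 — 11 statements merged into one kernel-verified Lean document; each statement's English description precedes it below -/
import Mathlib

section
/- Let (X,τ) be a topological space and let X₁ = {x ∈ X : {x} is nowhere dense}. A subset A of X is hereditarily sg-closed if and only if X₁ ∩ Int(cl(A)) = ∅. -/
open Set TopologicalSpace

/-- A set is semi-open if it is contained in the closure of its interior. -/
def SemiOpen {X : Type*} [TopologicalSpace X] (A : Set X) : Prop :=
  A ⊆ closure (interior A)

/-- A set is semi-closed if the interior of its closure is contained in it. -/
def SemiClosed {X : Type*} [TopologicalSpace X] (A : Set X) : Prop :=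
  interior (closure A) ⊆ A

/-- The semi-closure of a set: intersection of all semi-closed supersets. -/
def sCl {X : Type*} [TopologicalSpace X] (A : Set X) : Set X :=
  ⋂₀ {B | SemiClosed B ∧ A ⊆ B}

/-- A set is sg-closed if its semi-closure is contained in every semi-open superset. -/
def SgClosed {X : Type*} [TopologicalSpace X] (A : Set X) : Prop :=
  ∀ U : Set X, SemiOpen U → A ⊆ U → sCl A ⊆ U

/-- A set is sg-open if its complement is sg-closed. -/
def SgOpen {X : Type*} [TopologicalSpace X] (A : Set X) : Prop :=
  SgClosed Aᶜ

/-- A set is hereditarily sg-closed if every subset of it is sg-closed. -/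
def HSgClosed {X : Type*} [TopologicalSpace X] (A : Set X) : Prop :=
  ∀ B ⊆ A, SgClosed B

/-- A space is sg-compact if every cover by sg-open sets has a finite subcover. -/
def SgCompact (X : Type*) [TopologicalSpace X] : Prop :=
  ∀ 𝒰 : Set (Set X), (∀ U ∈ 𝒰, SgOpen U) → ⋃₀ 𝒰 = univ →
    ∃ ℱ ⊆ 𝒰, ℱ.Finite ∧ ⋃₀ ℱ = univ

/-- A space is semi-compact if every cover by semi-open sets has a finite subcover. -/
def SemiCompact (X : Type*) [TopologicalSpace X] : Prop :=
  ∀ 𝒰 : Set (Set X), (∀ U ∈ 𝒰, SemiOpen U) → ⋃₀ 𝒰 = univ →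
    ∃ ℱ ⊆ 𝒰, ℱ.Finite ∧ ⋃₀ ℱ = univ

/-- A C₂-space: every nowhere dense subset is finite. -/
def C2Space (X : Type*) [TopologicalSpace X] : Prop :=
  ∀ A : Set X, interior (closure A) = ∅ → A.Finite

/-- A C₃-space: every hereditarily sg-closed subset is finite. -/
def C3Space (X : Type*) [TopologicalSpace X] : Prop :=
  ∀ A : Set X, HSgClosed A → A.Finite

/-- A set is regular open if it equals the interior of its closure. -/
def RegularOpen {X : Type*} [TopologicalSpace X] (A : Set X) : Prop :=
  A = interior (closure A)

/-- A set is δ-open if it is a union of regular open sets. -/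
def DeltaOpen {X : Type*} [TopologicalSpace X] (A : Set X) : Prop :=
  ∃ 𝒞 : Set (Set X), (∀ R ∈ 𝒞, RegularOpen R) ∧ A = ⋃₀ 𝒞

theorem interior_closure_subset_sCl {X : Type*} [TopologicalSpace X] (A : Set X) :
    interior (closure A) ⊆ sCl A := fun _ hx _ hB =>
  hB.1 (interior_mono (closure_mono hB.2) hx)

theorem sCl_subset_union_interior_closure {X : Type*} [TopologicalSpace X] (A : Set X) :
    sCl A ⊆ A ∪ interior (closure A) := by
  refine sInter_subset_of_mem ⟨?_, subset_union_left⟩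
  have h : closure (A ∪ interior (closure A)) ⊆ closure A :=
    closure_minimal (union_subset subset_closure interior_subset) isClosed_closure
  exact (interior_mono h).trans subset_union_right

theorem dense_compl_closure_singleton {X : Type*} [TopologicalSpace X] {x : X}
    (hx : interior (closure {x}) = ∅) : Dense (closure {x})ᶜ :=
  interior_eq_empty_iff_dense_compl.1 hx

theorem semiOpen_compl_singleton {X : Type*} [TopologicalSpace X] {x : X}
    (hx : interior (closure {x}) = ∅) : SemiOpen ({x}ᶜ : Set X) := by
  intro y _
  rw [interior_compl]
  exact dense_compl_closure_singleton hx y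

theorem interior_closure_subset_interior_closure_sdiff {X : Type*} [TopologicalSpace X]
    {A N : Set X} (hN : IsClosed N) (hd : Dense Nᶜ) :
    interior (closure A) ⊆ interior (closure (A \ N)) := by
  refine interior_maximal ?_ isOpen_interior
  refine (hd.open_subset_closure_inter isOpen_interior).trans
    (closure_minimal ?_ isClosed_closure)
  rintro y ⟨hyA, hyN⟩
  have h := hN.isOpen_compl.inter_closure ⟨hyN, interior_subset hyA⟩
  rwa [inter_comm, ← sdiff_eq] at h

theorem mem_interior_closure_singleton {X : Type*} [TopologicalSpace X] {x : X}
    (hx : (interior (closure {x})).Nonempty) : x ∈ interior (closure {x}) := by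
  obtain ⟨v, hv⟩ := hx
  obtain ⟨_, hw, rfl⟩ := mem_closure_iff.1 (interior_subset hv) _ isOpen_interior hv
  exact hw

theorem SemiOpen.mem_of_mem_closure {X : Type*} [TopologicalSpace X] {U B : Set X} {x : X}
    (hU : SemiOpen U) (hBU : B ⊆ U) (hx : (interior (closure {x})).Nonempty)
    (hxB : x ∈ closure B) : x ∈ U := by
  obtain ⟨b, hbV, hbB⟩ :=
    mem_closure_iff.1 hxB _ isOpen_interior (mem_interior_closure_singleton hx)
  obtain ⟨w, hwV, hwU⟩ := mem_closure_iff.1 (hU (hBU hbB)) _ isOpen_interior hbV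
  obtain ⟨_, hz, rfl⟩ := mem_closure_iff.1 (interior_subset hwV) _ isOpen_interior hwU
  exact interior_subset hz

/-- `A` is hereditarily sg-closed iff `X₁ ∩ Int(cl A) = ∅`,
where `X₁` is the set of points whose singleton is nowhere dense. -/
theorem stmt_0 {X : Type*} [TopologicalSpace X] (A : Set X) :
    HSgClosed A ↔
      {x : X | interior (closure {x}) = ∅} ∩ interior (closure A) = ∅ := by
  constructor
  · intro hA
    rw [eq_empty_iff_forall_notMem]
    rintro x ⟨hx, hxA⟩
    have hsub : A \ closure {x} ⊆ {x}ᶜ := fun y hy hyx => hy.2 (subset_closure hyx)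
    exact hA (A \ closure {x}) sdiff_subset _ (semiOpen_compl_singleton hx) hsub
      (interior_closure_subset_sCl _ (interior_closure_subset_interior_closure_sdiff
        isClosed_closure (dense_compl_closure_singleton hx) hxA)) rfl
  · intro h B hBA U hU hBU x hx
    rcases sCl_subset_union_interior_closure B hx with hxB | hxB
    · exact hBU hxB
    · refine hU.mem_of_mem_closure hBU (nonempty_iff_ne_empty.2 fun hx₁ => ?_)
        (interior_subset hxB)
      exact eq_empty_iff_forall_notMem.1 h x ⟨hx₁, interior_mono (closure_mono hBA) hxB⟩
end

section
/- Let (X,τ) be a C₂-space. Then every infinite cellular family in X has an infinite subfamily whose union is contained in X₂ = {x ∈ X : {x} is locally dense}. -/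
open Set TopologicalSpace

/-- A set consisting of one point `f U` from each member `U` of a disjoint family of open sets,
none of these points having a locally dense singleton, is nowhere dense. -/
theorem interior_closure_image_eq_empty_of_pairwiseDisjoint {X : Type*} [TopologicalSpace X]
    {𝒞 : Set (Set X)} (hopen : ∀ U ∈ 𝒞, IsOpen U) (hdisj : 𝒞.PairwiseDisjoint id)
    {f : Set X → X} (hf : ∀ U ∈ 𝒞, f U ∈ U) (hf' : ∀ U ∈ 𝒞, f U ∉ interior (closure {f U})) :
    interior (closure (f '' 𝒞)) = ∅ := by
  by_contra hW
  obtain ⟨w, hw⟩ := nonempty_iff_ne_empty.mpr hW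
  obtain ⟨_, hxW, U, hU, rfl⟩ :=
    mem_closure_iff.mp (interior_subset hw) _ isOpen_interior hw
  refine hf' U hU (mem_interior.mpr
    ⟨U ∩ interior (closure (f '' 𝒞)), ?_, (hopen U hU).inter isOpen_interior, hf U hU, hxW⟩)
  rintro y ⟨hyU, hyW⟩
  refine closure_mono ?_ ((hopen U hU).inter_closure ⟨hyU, interior_subset hyW⟩)
  rintro _ ⟨hzU, V, hV, rfl⟩
  have hVU : V = U := hdisj.elim_set hV hU (f V) (hf V hV) hzU
  rw [hVU]
  rfl

/-- In a C₂-space, every infinite cellular family has an infinite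
subfamily whose union is contained in `X₂` (points with locally dense singleton). -/
theorem stmt_1 {X : Type*} [TopologicalSpace X] (h : C2Space X)
    (𝒞 : Set (Set X)) (hopen : ∀ U ∈ 𝒞, IsOpen U) (hne : ∀ U ∈ 𝒞, U.Nonempty)
    (hdisj : 𝒞.PairwiseDisjoint id) (hinf : 𝒞.Infinite) :
    ∃ 𝒟 ⊆ 𝒞, 𝒟.Infinite ∧ ⋃₀ 𝒟 ⊆ {x : X | x ∈ interior (closure {x})} := by
  refine ⟨{U ∈ 𝒞 | U ⊆ {x : X | x ∈ interior (closure {x})}}, fun U hU => hU.1, ?_,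
    sUnion_subset fun U hU => hU.2⟩
  intro hfin
  set 𝒩 := 𝒞 \ {U ∈ 𝒞 | U ⊆ {x : X | x ∈ interior (closure {x})}}
  have hpt : ∀ U : Set X, ∃ x, U ∈ 𝒩 → x ∈ U ∧ x ∉ interior (closure {x}) := by
    intro U
    by_cases hU : U ∈ 𝒩
    · obtain ⟨x, hx, hx'⟩ := not_subset.mp fun hsub => hU.2 ⟨hU.1, hsub⟩
      exact ⟨x, fun _ => ⟨hx, hx'⟩⟩
    · exact ⟨(hne _ hinf.nonempty.some_mem).some, fun hU' => absurd hU' hU⟩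
  choose f hf using hpt
  have hdisj' : 𝒩.PairwiseDisjoint id := hdisj.subset sdiff_subset
  have hinj : InjOn f 𝒩 := fun U hU V hV hUV =>
    hdisj'.elim_set hU hV (f U) (hf U hU).1 (hUV ▸ (hf V hV).1)
  exact (hinf.sdiff hfin).image hinj (h _ (interior_closure_image_eq_empty_of_pairwiseDisjoint
    (fun U hU => hopen U hU.1) hdisj' (fun U hU => (hf U hU).1) fun U hU => (hf U hU).2))
end

section
/- Every C₃-space (X,τ) is semi-compact. -/
open Set TopologicalSpace

section

variable {X : Type*} [TopologicalSpace X]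

theorem sCl_subset_union (A : Set X) : sCl A ⊆ A ∪ interior (closure A) := by
  refine sInter_subset_of_mem ⟨?_, subset_union_left⟩
  have hcl : closure (A ∪ interior (closure A)) ⊆ closure A :=
    closure_minimal (union_subset subset_closure interior_subset) isClosed_closure
  exact (interior_mono hcl).trans subset_union_right

/-- A set is hereditarily sg-closed as soon as the interior of its closure contains no point whose
singleton is nowhere dense. -/
theorem HSgClosed.of_forall_mem {A : Set X}
    (h : ∀ x ∈ interior (closure A), x ∈ interior (closure {x})) : HSgClosed A := by
  intro B hBA U hU hBU x hx
  rcases sCl_subset_union B hx with hxB | hxB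
  · exact hBU hxB
  have hx' := h x (interior_mono (closure_mono hBA) hxB)
  obtain ⟨b, hb, hbB⟩ := mem_closure_iff.1 (interior_subset hxB) _ isOpen_interior hx'
  obtain ⟨u, hu, huU⟩ := mem_closure_iff.1 (hU (hBU hbB)) _ isOpen_interior hb
  obtain ⟨y, hyU, hyx⟩ := mem_closure_iff.1 (interior_subset hu) _ isOpen_interior huU
  rw [mem_singleton_iff] at hyx
  exact interior_subset (hyx ▸ hyU)

theorem C3Space.c2Space (h : C3Space X) : C2Space X := fun A hA =>
  h A (HSgClosed.of_forall_mem fun x hx => by simp [hA] at hx)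

theorem C3Space.not_pairwise_disjoint (h : C3Space X) {V : ℕ → Set X} (hopen : ∀ n, IsOpen (V n))
    (hne : ∀ n, (V n).Nonempty) : ¬ Pairwise fun m n => Disjoint (V m) (V n) := by
  intro hdisj
  have hidx : ∀ {m n x}, x ∈ V m → x ∈ V n → m = n := fun {m n x} hm hn =>
    by_contra fun hmn => disjoint_left.1 (hdisj hmn) hm hn
  have hchoice : ∀ n, ∃ y ∈ V n, (∃ x ∈ V n, x ∉ interior (closure {x})) →
      y ∉ interior (closure {y}) := by
    intro n
    by_cases hn : ∃ x ∈ V n, x ∉ interior (closure {x})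
    · obtain ⟨x, hx, hx'⟩ := hn
      exact ⟨x, hx, fun _ => hx'⟩
    · exact ⟨(hne n).some, (hne n).some_mem, fun hn' => absurd hn' hn⟩
  choose a haV ha using hchoice
  have hainj : Function.Injective a := fun m n hmn => hidx (haV m) (hmn ▸ haV n)
  have hinside : ∀ (S : Set ℕ) (n : ℕ), ∀ x ∈ V n, x ∈ interior (closure (a '' S)) →
      x ∈ interior (closure {x}) := by
    intro S n x hxV hxS
    by_contra hx
    have hsub : V n ∩ interior (closure (a '' S)) ⊆ closure {a n} := by
      refine (inter_subset_inter_right _ interior_subset).trans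
        ((hopen n).inter_closure.trans (closure_mono ?_))
      rintro _ ⟨hV, m, -, rfl⟩
      rw [hidx (haV m) hV]
      rfl
    have hmem : x ∈ interior (closure {a n}) :=
      interior_maximal hsub ((hopen n).inter isOpen_interior) ⟨hxV, hxS⟩
    obtain ⟨y, hy, hya⟩ := mem_closure_iff.1 (interior_subset hmem) _ isOpen_interior hmem
    rw [mem_singleton_iff] at hya
    exact ha n ⟨x, hxV, hx⟩ (hya ▸ hy)
  have hUopen : IsOpen (⋃ n, V n) := isOpen_iUnion hopen
  have hfin : (frontier (⋃ n, V n)).Finite := by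
    apply h.c2Space
    rw [isClosed_frontier.closure_eq, ← frontier_compl]
    exact interior_frontier hUopen.isClosed_compl
  have hpoint : ∀ k, ∃ x ∈ frontier (⋃ n, V n),
      x ∈ interior (closure (a '' range (Nat.pair k))) := by
    intro k
    have hinf : (a '' range (Nat.pair k)).Infinite := by
      refine (infinite_range_of_injective fun m n hmn => ?_).image hainj.injOn
      exact (Nat.pair_eq_pair.1 hmn).2
    have hnot : ¬ ∀ x ∈ interior (closure (a '' range (Nat.pair k))),
        x ∈ interior (closure {x}) := fun hall => hinf (h _ (HSgClosed.of_forall_mem hall))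
    push Not at hnot
    obtain ⟨x, hx, hx'⟩ := hnot
    refine ⟨x, ?_, hx⟩
    rw [hUopen.frontier_eq]
    refine ⟨closure_mono ?_ (interior_subset hx), fun hxU => ?_⟩
    · rintro _ ⟨n, -, rfl⟩
      exact mem_iUnion.2 ⟨n, haV n⟩
    · obtain ⟨n, hn⟩ := mem_iUnion.1 hxU
      exact hx' (hinside _ n x hn hx)
  choose p hpfr hp using hpoint
  have hpinj : Function.Injective p := by
    intro k l hkl
    obtain ⟨_, hyl, _, ⟨m, rfl⟩, rfl⟩ := mem_closure_iff.1 (interior_subset (hp k)) _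
      isOpen_interior (hkl ▸ hp l)
    obtain ⟨_, hz, _, ⟨m', rfl⟩, rfl⟩ := mem_closure_iff.1 (interior_subset hyl) _
      (hopen _) (haV _)
    exact (Nat.pair_eq_pair.1 (hidx (haV _) hz)).1.symm
  exact infinite_of_injective_forall_mem hpinj hpfr hfin

/-- If there is no infinite sequence of pairwise disjoint nonempty open sets, then every cover by
semi-open sets has a finite subfamily with dense union. -/
theorem exists_finite_dense_sUnion
    (h : ∀ V : ℕ → Set X, (∀ n, IsOpen (V n)) → (∀ n, (V n).Nonempty) →
      ¬ Pairwise fun m n => Disjoint (V m) (V n))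
    {𝒰 : Set (Set X)} (hU : ∀ U ∈ 𝒰, SemiOpen U) (hcov : ⋃₀ 𝒰 = univ) :
    ∃ ℱ ⊆ 𝒰, ℱ.Finite ∧ Dense (⋃₀ ℱ) := by
  classical
  by_contra! hnd
  obtain ⟨f, hf, hfr⟩ := exists_seq_of_forall_finset_exists
    (fun q : Set X × Set X => q.1 ∈ 𝒰 ∧ IsOpen q.2 ∧ q.2.Nonempty ∧ q.2 ⊆ q.1)
    (fun q r => Disjoint q.1 r.2) (by
      intro s hs
      have hd := hnd (Prod.fst '' (s : Set (Set X × Set X)))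
        (by rintro _ ⟨q, hq, rfl⟩; exact (hs q hq).1) (s.finite_toSet.image _)
      rw [Dense] at hd
      push Not at hd
      obtain ⟨x, hx⟩ := hd
      obtain ⟨U, hUm, hxU⟩ := mem_sUnion.1 (hcov ▸ mem_univ x)
      obtain ⟨y, hy, hyU⟩ := mem_closure_iff.1 (hU U hUm hxU) _ isClosed_closure.isOpen_compl hx
      refine ⟨(U, interior U ∩ (closure (⋃₀ (Prod.fst '' (s : Set (Set X × Set X)))))ᶜ),
        ⟨hUm, isOpen_interior.inter isClosed_closure.isOpen_compl, ⟨y, hyU, hy⟩,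
          inter_subset_left.trans interior_subset⟩, fun q hq => ?_⟩
      refine disjoint_left.2 fun z hzq hz => hz.2 (subset_closure ?_)
      exact mem_sUnion.2 ⟨q.1, ⟨q, hq, rfl⟩, hzq⟩)
  refine h (fun n => (f n).2) (fun n => (hf n).2.1) (fun n => (hf n).2.2.1) fun m n hmn => ?_
  rcases lt_or_gt_of_ne hmn with hlt | hlt
  · exact (hfr m n hlt).mono_left (hf m).2.2.2
  · exact ((hfr n m hlt).mono_left (hf n).2.2.2).symm

theorem SemiOpen.sUnion {ℱ : Set (Set X)} (hℱ : ∀ U ∈ ℱ, SemiOpen U) : SemiOpen (⋃₀ ℱ) :=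
  sUnion_subset fun U hU =>
    (hℱ U hU).trans (closure_mono (interior_mono (subset_sUnion_of_mem hU)))

theorem SemiOpen.interior_closure_compl_eq_empty {A : Set X} (hA : SemiOpen A) (hd : Dense A) :
    interior (closure Aᶜ) = ∅ := by
  rw [closure_compl, interior_compl, compl_empty_iff, ← dense_iff_closure_eq]
  exact hd.closure.mono (closure_minimal hA isClosed_closure) |>.of_closure

end

/-- Every C₃-space is semi-compact. -/
theorem stmt_2 {X : Type*} [TopologicalSpace X] (h : C3Space X) :
    SemiCompact X := by
  intro 𝒰 hU hcov
  obtain ⟨ℱ, hℱ, hfin, hdense⟩ :=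
    exists_finite_dense_sUnion (fun _ ho hn => h.not_pairwise_disjoint ho hn) hU hcov
  have hrest : (⋃₀ ℱ)ᶜ.Finite := h.c2Space _ <|
    (SemiOpen.sUnion fun U hU' => hU U (hℱ hU')).interior_closure_compl_eq_empty hdense
  have hmem : ∀ x : X, ∃ U ∈ 𝒰, x ∈ U := fun x => mem_sUnion.1 (hcov ▸ mem_univ x)
  choose g hg hxg using hmem
  refine ⟨ℱ ∪ g '' (⋃₀ ℱ)ᶜ, union_subset hℱ ?_, hfin.union (hrest.image g), ?_⟩
  · rintro _ ⟨x, -, rfl⟩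
    exact hg x
  · refine eq_univ_of_forall fun x => ?_
    by_cases hx : x ∈ ⋃₀ ℱ
    · exact sUnion_mono subset_union_left hx
    · exact mem_sUnion.2 ⟨g x, Or.inr ⟨x, hx, rfl⟩, hxg x⟩
end

section
/- Let (X,τ) be a topological space. If A ⊆ X is sg-closed and B ⊆ X is closed, then A ∪ B is sg-closed. -/
open Set TopologicalSpace

theorem SemiClosed.union_isClosed {X : Type*} [TopologicalSpace X] {A B : Set X}
    (hA : SemiClosed A) (hB : IsClosed B) : SemiClosed (A ∪ B) := by
  intro x hx
  by_cases hxB : x ∈ B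
  · exact Or.inr hxB
  rw [closure_union, hB.closure_eq] at hx
  refine Or.inl (hA (mem_interior.2 ⟨interior (closure A ∪ B) ∩ Bᶜ, ?_,
    isOpen_interior.inter hB.isOpen_compl, hx, hxB⟩))
  rintro y ⟨hy, hyB⟩
  exact (interior_subset hy).resolve_right hyB

theorem semiClosed_sCl {X : Type*} [TopologicalSpace X] (A : Set X) : SemiClosed (sCl A) :=
  fun _ hx _ hC => hC.1 (interior_mono (closure_mono (sInter_subset_of_mem hC)) hx)

theorem subset_sCl {X : Type*} [TopologicalSpace X] (A : Set X) : A ⊆ sCl A :=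
  subset_sInter fun _ hC => hC.2

theorem sCl_subset {X : Type*} [TopologicalSpace X] {A C : Set X} (hC : SemiClosed C)
    (h : A ⊆ C) : sCl A ⊆ C :=
  sInter_subset_of_mem ⟨hC, h⟩

/-- The union of an sg-closed set and a closed set is sg-closed. -/
theorem stmt_5 {X : Type*} [TopologicalSpace X] {A B : Set X}
    (hA : SgClosed A) (hB : IsClosed B) : SgClosed (A ∪ B) := by
  intro U hU hAB
  have hsub : sCl (A ∪ B) ⊆ sCl A ∪ B :=
    sCl_subset ((semiClosed_sCl A).union_isClosed hB) (union_subset_union_left B (subset_sCl A))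
  exact hsub.trans (union_subset (hA U hU (subset_union_left.trans hAB))
    (subset_union_right.trans hAB))
end

section
/- Let X = {a,b,c,d} be a four-element set with topology τ = {∅, {a}, {b}, {a,b}, X}. Then {a} and {b} are semi-closed (hence sg-closed) in (X,τ), but their union {a,b} is not sg-closed. In particular, a finite union of sg-closed sets need not be sg-closed. -/
open Set TopologicalSpace

section

variable {X : Type*} [TopologicalSpace X]

theorem SemiClosed.sgClosed {A : Set X} (hA : SemiClosed A) : SgClosed A :=
  fun _ _ hAU => Subset.trans (fun _ hx => hx A ⟨hA, Subset.rfl⟩) hAU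

theorem IsOpen.semiOpen {A : Set X} (hA : IsOpen A) : SemiOpen A := by
  rw [SemiOpen, hA.interior_eq]
  exact subset_closure

theorem Dense.sCl_eq_univ {A : Set X} (hA : Dense A) : sCl A = univ :=
  sInter_eq_univ.2 fun B ⟨hB, hAB⟩ => by
    rwa [SemiClosed, (hA.mono hAB).closure_eq, interior_univ, univ_subset_iff] at hB

/-- A dense open proper subset is never sg-closed. -/
theorem Dense.not_sgClosed {A : Set X} (hA : Dense A) (hAo : IsOpen A) (hne : A ≠ univ) :
    ¬ SgClosed A := fun h =>
  hne (univ_subset_iff.1 (hA.sCl_eq_univ ▸ h A hAo.semiOpen Subset.rfl))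

/-- If `y` is an isolated point and every open set avoiding `y` is contained in `A ∌ y`,
then `A` is semi-closed. -/
theorem semiClosed_of_isOpen_singleton {A : Set X} {y : X} (hy : IsOpen {y}) (hyA : y ∉ A)
    (h : ∀ U : Set X, IsOpen U → y ∉ U → U ⊆ A) : SemiClosed A :=
  h _ isOpen_interior fun hmem =>
    ((disjoint_singleton_left.2 hyA).closure_right hy).notMem_of_mem_left rfl
      (interior_subset hmem)

end

/-- On `X = {a,b,c,d}` with topology `{∅,{a},{b},{a,b},X}`,
the sets `{a}` and `{b}` are semi-closed (hence sg-closed), but their union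
`{a,b}` is not sg-closed. -/
theorem stmt_7 {X : Type*} (a b c d : X)
    (hab : a ≠ b) (hac : a ≠ c) (had : a ≠ d)
    (hbc : b ≠ c) (hbd : b ≠ d) (hcd : c ≠ d)
    (hX : ∀ x : X, x = a ∨ x = b ∨ x = c ∨ x = d)
    (t : TopologicalSpace X)
    (ht : ∀ s : Set X, t.IsOpen s ↔
      s ∈ ({∅, {a}, {b}, {a, b}, univ} : Set (Set X))) :
    @SemiClosed X t {a} ∧ @SemiClosed X t {b} ∧
    @SgClosed X t {a} ∧ @SgClosed X t {b} ∧
    ¬ @SgClosed X t {a, b} := by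
  have ho : ∀ s : Set X, IsOpen s ↔ s = ∅ ∨ s = {a} ∨ s = {b} ∨ s = {a, b} ∨ s = univ := ht
  have ha : SemiClosed ({a} : Set X) := by
    refine semiClosed_of_isOpen_singleton (y := b) ((ho _).2 (by simp)) hab.symm fun U hU hb => ?_
    rcases (ho U).1 hU with rfl | rfl | rfl | rfl | rfl <;> simp_all
  have hb : SemiClosed ({b} : Set X) := by
    refine semiClosed_of_isOpen_singleton (y := a) ((ho _).2 (by simp)) hab fun U hU ha => ?_
    rcases (ho U).1 hU with rfl | rfl | rfl | rfl | rfl <;> simp_all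
  have hd : Dense ({a, b} : Set X) := by
    refine dense_iff_inter_open.2 fun U hU hne => ?_
    rcases (ho U).1 hU with rfl | rfl | rfl | rfl | rfl
    · exact absurd hne not_nonempty_empty
    · exact ⟨a, by simp⟩
    · exact ⟨b, by simp⟩
    · exact ⟨a, by simp⟩
    · exact ⟨a, by simp⟩
  have hne : ({a, b} : Set X) ≠ univ :=
    (ne_univ_iff_exists_notMem _).2 ⟨c, by simp [hac.symm, hbc.symm]⟩
  exact ⟨ha, hb, ha.sgClosed, hb.sgClosed, hd.not_sgClosed ((ho _).2 (by simp)) hne⟩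
end

section
/- Let R be a regular open subset of a topological space (X,τ). If A ⊆ R and A is sg-open in the subspace (R, τ|R), then A is sg-open in (X,τ). -/
open Set TopologicalSpace

theorem semiOpen_compl_iff {X : Type*} [TopologicalSpace X] {A : Set X} :
    SemiOpen Aᶜ ↔ SemiClosed A := by
  rw [SemiOpen, SemiClosed, interior_compl, closure_compl, compl_subset_compl]

theorem SemiOpen.preimage {X Y : Type*} [TopologicalSpace X] [TopologicalSpace Y] {f : X → Y}
    (hf : Continuous f) (hfo : IsOpenMap f) {U : Set Y} (hU : SemiOpen U) :
    SemiOpen (f ⁻¹' U) := by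
  rw [SemiOpen, ← hfo.preimage_interior_eq_interior_preimage hf,
    ← hfo.preimage_closure_eq_closure_preimage hf]
  exact preimage_mono hU

theorem SemiOpen.image {X Y : Type*} [TopologicalSpace X] [TopologicalSpace Y] {f : X → Y}
    (hf : Continuous f) (hfo : IsOpenMap f) {U : Set X} (hU : SemiOpen U) :
    SemiOpen (f '' U) :=
  (image_mono hU).trans <| (image_closure_subset_closure_image hf).trans <|
    closure_mono (hfo.image_interior_subset U)

/-- Only the openness of `R` is needed to pass sg-openness from the subspace `R` to `X`. -/
theorem SgOpen.of_preimage_val {X : Type*} [TopologicalSpace X] {R : Set X} (hR : IsOpen R)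
    {A : Set X} (hAR : A ⊆ R) (h : SgOpen ((Subtype.val ⁻¹' A) : Set R)) : SgOpen A := by
  intro U hU hAU x hx
  by_contra hxU
  have hxA : x ∈ A := by_contra fun hxA => hxU (hAU hxA)
  have hval : IsOpenMap (Subtype.val : R → X) := hR.isOpenMap_subtype_val
  refine hxU (h _ (hU.preimage continuous_subtype_val hval) (preimage_mono hAU)
    (show (⟨x, hAR hxA⟩ : R) ∈ _ from ?_))
  rintro B ⟨hB, hAB⟩
  by_contra hxB
  refine hx (Subtype.val '' Bᶜ)ᶜ ⟨?_, ?_⟩ ⟨⟨x, hAR hxA⟩, hxB, rfl⟩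
  · rw [← semiOpen_compl_iff, compl_compl]
    exact (semiOpen_compl_iff.2 hB).image continuous_subtype_val hval
  · rintro y hyA ⟨z, hzB, rfl⟩
    exact hzB (hAB hyA)

/-- If `R` is regular open, `A ⊆ R` and `A` is sg-open in the
subspace `R`, then `A` is sg-open in `X`. -/
theorem stmt_8 {X : Type*} [TopologicalSpace X] {R : Set X}
    (hR : RegularOpen R) {A : Set X} (hAR : A ⊆ R)
    (h : SgOpen ((Subtype.val ⁻¹' A) : Set R)) :
    SgOpen A :=
  SgOpen.of_preimage_val (hR.symm ▸ isOpen_interior) hAR h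
end

section
/- Every δ-open subset of an sg-compact topological space (X,τ), equipped with the subspace topology, is sg-compact. In particular, sg-compactness is hereditary with respect to regular open sets. -/
open Set TopologicalSpace

/-- A set is sg-open iff each of its points with nowhere dense singleton lies in the closure of
its interior. -/
lemma sgOpen_iff {X : Type*} [TopologicalSpace X] {U : Set X} :
    SgOpen U ↔ ∀ x ∈ U, interior (closure {x}) = ∅ → x ∈ closure (interior U) := by
  constructor
  · intro hU x hxU hx
    have hsemi : SemiOpen ({x}ᶜ : Set X) := by
      intro y _
      rw [interior_compl, closure_compl, hx]
      simp
    have hsub : Uᶜ ⊆ ({x}ᶜ : Set X) := compl_subset_compl.2 (singleton_subset_iff.2 hxU)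
    by_contra hcl
    refine (hU _ hsemi hsub : sCl Uᶜ ⊆ {x}ᶜ) (a := x) ?_ rfl
    rintro B ⟨hB, hUB⟩
    apply hB
    apply interior_mono (closure_mono hUB)
    rw [closure_compl, interior_compl]
    exact hcl
  · intro h O hO hUO x hx
    by_cases hxU : x ∈ U
    · have hB : SemiClosed (Uᶜ ∪ interior (closure Uᶜ)) := by
        refine (interior_mono ?_).trans subset_union_right
        exact closure_minimal (union_subset subset_closure interior_subset) isClosed_closure
      have hxi : x ∈ interior (closure Uᶜ) := by
        rcases hx _ ⟨hB, subset_union_left⟩ with h' | h'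
        · exact absurd hxU h'
        · exact h'
      have hne : (interior (closure ({x} : Set X))).Nonempty := by
        rw [nonempty_iff_ne_empty]
        intro he
        have := h x hxU he
        rw [closure_compl, interior_compl] at hxi
        exact hxi this
      have hxx : x ∈ interior (closure ({x} : Set X)) := by
        obtain ⟨z, hz⟩ := hne
        obtain ⟨w, hw, rfl⟩ := mem_closure_iff.1 (interior_subset hz) _ isOpen_interior hz
        exact hw
      obtain ⟨a, ha, haU⟩ := mem_closure_iff.1 (interior_subset hxi) _ isOpen_interior hxx
      obtain ⟨b, hb, hbO⟩ := mem_closure_iff.1 (hO (hUO haU)) _ isOpen_interior ha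
      obtain ⟨c, hc, rfl⟩ := mem_closure_iff.1 (interior_subset hb) _ isOpen_interior hbO
      exact interior_subset hc
    · exact hUO hxU

lemma SemiOpen.sgOpen {X : Type*} [TopologicalSpace X] {U : Set X} (h : SemiOpen U) :
    SgOpen U :=
  sgOpen_iff.2 fun _ hx _ => h hx

lemma IsOpen.semiOpen_s10 {X : Type*} [TopologicalSpace X] {U : Set X} (h : IsOpen U) :
    SemiOpen U := by
  rw [SemiOpen, h.interior_eq]
  exact subset_closure

lemma SgOpen.image_val {X : Type*} [TopologicalSpace X] {A : Set X} (hA : IsOpen A) {U : Set A}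
    (hU : SgOpen U) : SgOpen (Subtype.val '' U : Set X) := by
  have hemb := hA.isOpenEmbedding_subtypeVal
  rw [sgOpen_iff] at hU ⊢
  rintro _ ⟨x, hxU, rfl⟩ hx
  have hxA : interior (closure ({x} : Set A)) = ∅ := by
    have hpre : (Subtype.val ⁻¹' {(x : X)} : Set A) = {x} := by
      ext y; simp [Subtype.ext_iff]
    rw [← hpre, ← hemb.isOpenMap.preimage_closure_eq_closure_preimage hemb.continuous,
      ← hemb.isOpenMap.preimage_interior_eq_interior_preimage hemb.continuous, hx, preimage_empty]
  have := image_closure_subset_closure_image hemb.continuous (mem_image_of_mem _ (hU x hxU hxA))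
  exact closure_mono (hemb.isOpenMap.image_interior_subset _) this

lemma RegularOpen.isOpen {X : Type*} [TopologicalSpace X] {R : Set X} (h : RegularOpen R) :
    IsOpen R := by
  rw [h]; exact isOpen_interior

lemma RegularOpen.semiOpen_compl {X : Type*} [TopologicalSpace X] {R : Set X}
    (h : RegularOpen R) : SemiOpen Rᶜ := by
  rw [SemiOpen, interior_compl, closure_compl, ← h]

lemma RegularOpen.deltaOpen {X : Type*} [TopologicalSpace X] {R : Set X} (h : RegularOpen R) :
    DeltaOpen R :=
  ⟨{R}, by simpa using h, by simp⟩

lemma DeltaOpen.isOpen {X : Type*} [TopologicalSpace X] {A : Set X} (h : DeltaOpen A) :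
    IsOpen A := by
  obtain ⟨𝒞, h𝒞, rfl⟩ := h
  exact isOpen_sUnion fun R hR => (h𝒞 R hR).isOpen

lemma SgCompact.finite_subcover_regularOpen {X : Type*} [TopologicalSpace X] (h : SgCompact X)
    {R : Set X} (hR : RegularOpen R) {𝒲 : Set (Set X)} (h𝒲 : ∀ W ∈ 𝒲, SgOpen W)
    (hcov : R ⊆ ⋃₀ 𝒲) : ∃ ℱ ⊆ 𝒲, ℱ.Finite ∧ R ⊆ ⋃₀ ℱ := by
  obtain ⟨ℱ, hℱ, hfin, hu⟩ := h (insert Rᶜ 𝒲)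
    (by
      rintro U (rfl | hU)
      · exact hR.semiOpen_compl.sgOpen
      · exact h𝒲 U hU)
    (by
      rw [sUnion_insert, eq_univ_iff_forall]
      intro x
      by_cases hx : x ∈ R
      · exact Or.inr (hcov hx)
      · exact Or.inl hx)
  refine ⟨ℱ ∩ 𝒲, inter_subset_right, hfin.inter_of_left _, fun x hx => ?_⟩
  obtain ⟨U, hU, hxU⟩ := (hu ▸ mem_univ x : x ∈ ⋃₀ ℱ)
  rcases hℱ hU with rfl | hU'
  · exact absurd hx hxU
  · exact ⟨U, ⟨hU, hU'⟩, hxU⟩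

lemma SgCompact.c2Space {X : Type*} [TopologicalSpace X] (h : SgCompact X) : C2Space X := by
  intro S hS
  by_cases hne : S.Nonempty
  · obtain ⟨ℱ, hℱ, hfin, hu⟩ := h ((fun x => Sᶜ ∪ {x}) '' S)
      (by
        rintro _ ⟨x, -, rfl⟩
        refine SemiOpen.sgOpen fun y _ => ?_
        refine closure_mono (interior_mono (subset_union_left (s := Sᶜ))) ?_
        rw [interior_compl, closure_compl, hS]
        simp)
      (by
        rw [eq_univ_iff_forall]
        intro y
        by_cases hy : y ∈ S
        · exact ⟨_, ⟨y, hy, rfl⟩, Or.inr rfl⟩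
        · obtain ⟨x, hx⟩ := hne
          exact ⟨_, ⟨x, hx, rfl⟩, Or.inl hy⟩)
    obtain ⟨T, hTS, hT, hTu⟩ := exists_subset_image_finite_and
      (p := fun 𝒯 => ⋃₀ 𝒯 = univ) |>.1 ⟨ℱ, hℱ, hfin, hu⟩
    refine hT.subset fun y hy => ?_
    obtain ⟨_, ⟨x, hx, rfl⟩, hyx⟩ := (hTu ▸ mem_univ y : y ∈ ⋃₀ ((fun x => Sᶜ ∪ {x}) '' T))
    rcases hyx with h' | rfl
    · exact absurd hy h'
    · exact hx
  · rw [not_nonempty_iff_eq_empty.1 hne]; exact finite_empty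

/-- An sg-compact space has no infinite sequence of pairwise disjoint nonempty open sets. -/
lemma SgCompact.not_pairwise_disjoint {X : Type*} [TopologicalSpace X] (h : SgCompact X)
    (V : ℕ → Set X) (ho : ∀ n, IsOpen (V n)) (hne : ∀ n, (V n).Nonempty)
    (hd : ∀ m n x, x ∈ V m → x ∈ V n → m = n) : False := by
  set W := ⋃ n, V n
  have hWo : IsOpen W := isOpen_iUnion ho
  set F := closure W \ W
  have hFfin : F.Finite := by
    apply h.c2Space
    have hFc : IsClosed F := isClosed_closure.sdiff hWo
    rw [hFc.closure_eq, eq_empty_iff_forall_notMem]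
    intro x hx
    obtain ⟨y, hy, hyW⟩ := mem_closure_iff.1 (interior_subset hx).1 _ isOpen_interior hx
    exact (interior_subset hy).2 hyW
  set k := hFfin.toFinset.card
  have hparts : ∀ p : F, ∃ j : Fin (k + 1),
      (p : X) ∈ closure (⋃ n ∈ {n | n % (k + 1) = j}, V n) := by
    intro p
    rw [← mem_iUnion, ← closure_iUnion_of_finite]
    refine closure_mono ?_ p.2.1
    refine iUnion_subset fun n x hx => ?_
    exact mem_iUnion.2 ⟨⟨n % (k + 1), Nat.mod_lt _ k.succ_pos⟩, mem_biUnion (by simp) hx⟩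
  choose j hj using hparts
  obtain ⟨j₀, hj₀⟩ : ∃ j₀, ∀ p, j p ≠ j₀ := by
    by_contra! hs
    have : Finite F := hFfin
    have hc := Nat.card_le_card_of_surjective j hs
    rw [Nat.card_coe_set_eq, ncard_eq_toFinset_card F hFfin, Nat.card_fin] at hc
    omega
  set G := ⋃ n ∈ {n | n % (k + 1) ≠ j₀}, V n
  have hGo : IsOpen G := isOpen_biUnion fun n _ => ho n
  have hS : SemiOpen (F ∪ G) := by
    have hGi : G ⊆ interior (F ∪ G) := interior_maximal subset_union_right hGo
    refine (union_subset (fun p hp => ?_) subset_closure).trans (closure_mono hGi)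
    refine closure_mono ?_ (hj ⟨p, hp⟩)
    refine biUnion_subset_biUnion_left fun n hn => ?_
    rw [mem_ofPred_eq] at hn ⊢
    rw [hn]
    exact fun he => hj₀ ⟨p, hp⟩ (Fin.ext he)
  obtain ⟨ℱ, hℱ, hfin, hu⟩ := h (range V ∪ {(closure W)ᶜ, F ∪ G})
    (by
      rintro U (⟨n, rfl⟩ | rfl | rfl)
      · exact (ho n).semiOpen_s10.sgOpen
      · exact isClosed_closure.isOpen_compl.semiOpen_s10.sgOpen
      · exact hS.sgOpen)
    (by
      rw [eq_univ_iff_forall]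
      intro x
      by_cases hx : x ∈ closure W
      · by_cases hxW : x ∈ W
        · obtain ⟨n, hn⟩ := mem_iUnion.1 hxW
          exact ⟨V n, Or.inl ⟨n, rfl⟩, hn⟩
        · exact ⟨F ∪ G, Or.inr (Or.inr rfl), Or.inl ⟨hx, hxW⟩⟩
      · exact ⟨_, Or.inr (Or.inl rfl), hx⟩)
  have hinj : Function.Injective fun i : ℕ => V (j₀ + (k + 1) * i) := by
    intro a b hab
    obtain ⟨x, hx⟩ := hne (j₀ + (k + 1) * a)
    have := hd _ _ x hx ((show V _ = V _ from hab) ▸ hx)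
    exact Nat.eq_of_mul_eq_mul_left k.succ_pos (by simpa using this)
  obtain ⟨i, hi⟩ : ∃ i : ℕ, V (j₀ + (k + 1) * i) ∉ ℱ := by
    by_contra! hall
    exact infinite_of_injective_forall_mem hinj hall hfin
  obtain ⟨x, hx⟩ := hne (j₀ + (k + 1) * i)
  have hxW : x ∈ W := mem_iUnion.2 ⟨_, hx⟩
  obtain ⟨U, hU, hxU⟩ := (hu ▸ mem_univ x : x ∈ ⋃₀ ℱ)
  rcases hℱ hU with ⟨n, rfl⟩ | rfl | rfl
  · exact hi (hd _ _ x hx hxU ▸ hU)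
  · exact hxU (subset_closure hxW)
  · rcases hxU with hxF | hxG
    · exact hxF.2 hxW
    · obtain ⟨n, hn, hxn⟩ := mem_iUnion₂.1 hxG
      apply hn
      rw [← hd _ _ x hx hxn, Nat.add_mul_mod_self_left, Nat.mod_eq_of_lt j₀.2]

/-- If there is no infinite sequence of disjoint nonempty open sets, every nonempty open set
contains an irreducible open set. -/
lemma exists_isIrreducible_open_subset {X : Type*} [TopologicalSpace X]
    (h : ∀ V : ℕ → Set X, (∀ n, IsOpen (V n)) → (∀ n, (V n).Nonempty) →
      (∀ m n x, x ∈ V m → x ∈ V n → m = n) → False)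
    {U : Set X} (hU : IsOpen U) (hne : U.Nonempty) :
    ∃ V ⊆ U, IsOpen V ∧ IsIrreducible V := by
  by_contra! hno
  have hsplit : ∀ V : {V : Set X // V ⊆ U ∧ IsOpen V ∧ V.Nonempty},
      ∃ P : Set X, ∃ Q : {V : Set X // V ⊆ U ∧ IsOpen V ∧ V.Nonempty},
        P ⊆ V.1 ∧ IsOpen P ∧ P.Nonempty ∧ Q.1 ⊆ V.1 ∧ Disjoint P Q.1 := by
    rintro ⟨V, hVU, hVo, hVne⟩
    have hni : ¬ IsPreirreducible V := fun hp => hno V hVU hVo ⟨hVne, hp⟩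
    simp only [IsPreirreducible, not_forall] at hni
    obtain ⟨P, Q, hP, hQ, hVP, hVQ, hPQ⟩ := hni
    refine ⟨V ∩ P, ⟨V ∩ Q, inter_subset_left.trans hVU, hVo.inter hQ, hVQ⟩, inter_subset_left,
      hVo.inter hP, hVP, inter_subset_left, ?_⟩
    rw [disjoint_left]
    exact fun x hx hx' => hPQ ⟨x, hx.1, hx.2, hx'.2⟩
  choose P Q hPV hPo hPne hQV hPQ using hsplit
  set u : ℕ → {V : Set X // V ⊆ U ∧ IsOpen V ∧ V.Nonempty} :=
    fun n => Q^[n] ⟨U, Subset.rfl, hU, hne⟩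
  have hsucc : ∀ n, u (n + 1) = Q (u n) := fun n => Function.iterate_succ_apply' _ _ _
  have hanti : Antitone fun n => (u n).1 := antitone_nat_of_succ_le fun n => by
    rw [hsucc]; exact hQV _
  have hlt : ∀ m n x, m < n → x ∈ P (u m) → x ∈ P (u n) → False := by
    intro m n x hmn hxm hxn
    have : x ∈ (u (m + 1)).1 := hanti (Nat.succ_le_of_lt hmn) (hPV _ hxn)
    rw [hsucc] at this
    exact disjoint_left.1 (hPQ _) hxm this
  refine h (fun n => P (u n)) (fun n => hPo _) (fun n => hPne _) fun m n x hm hn => ?_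
  rcases lt_trichotomy m n with hmn | hmn | hmn
  · exact (hlt m n x hmn hm hn).elim
  · exact hmn
  · exact (hlt n m x hmn hn hm).elim

lemma SgCompact.finite_setOf_regularOpen {X : Type*} [TopologicalSpace X] (h : SgCompact X) :
    {R : Set X | RegularOpen R}.Finite := by
  set 𝒱 : Set (Set X) := {C | ∃ V, IsOpen V ∧ IsIrreducible V ∧ closure V = C}
  have hcl : ∀ V V' : Set X, IsOpen V → IsOpen V' → IsIrreducible V →
      (V ∩ V').Nonempty → closure V ⊆ closure V' := by
    intro V V' hV hV' hi hn
    refine closure_minimal (fun x hx => mem_closure_iff.2 fun O hO hxO => ?_) isClosed_closure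
    obtain ⟨y, -, hyO, hy⟩ := hi.2 O V' hO hV' ⟨x, hx, hxO⟩ hn
    exact ⟨y, hyO, hy⟩
  have hfin : 𝒱.Finite := by
    by_contra hinf
    have e := Set.Infinite.natEmbedding 𝒱 hinf
    choose V hVo hVi hVe using fun n => (e n).2
    refine h.not_pairwise_disjoint V hVo (fun n => (hVi n).1) fun m n x hm hn => ?_
    apply e.injective
    apply Subtype.ext
    rw [← hVe, ← hVe]
    exact (hcl _ _ (hVo m) (hVo n) (hVi m) ⟨x, hm, hn⟩).antisymm
      (hcl _ _ (hVo n) (hVo m) (hVi n) ⟨x, hn, hm⟩)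
  have hle : ∀ R R' : Set X, RegularOpen R → RegularOpen R' →
      {C ∈ 𝒱 | (C ∩ R).Nonempty} ⊆ {C ∈ 𝒱 | (C ∩ R').Nonempty} → R ⊆ R' := by
    intro R R' hR hR' hsub
    by_contra hnot
    have hne : (R \ closure R').Nonempty := by
      rw [sdiff_nonempty]
      intro hRc
      apply hnot
      rw [hR']
      exact interior_maximal hRc hR.isOpen
    obtain ⟨V, hVR, hVo, hVi⟩ := exists_isIrreducible_open_subset h.not_pairwise_disjoint
      (hR.isOpen.sdiff isClosed_closure) hne
    obtain ⟨v, hv⟩ := hVi.1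
    obtain ⟨-, y, hyV, hyR⟩ := hsub ⟨⟨V, hVo, hVi, rfl⟩, v, subset_closure hv, (hVR hv).1⟩
    obtain ⟨z, hzR, hzV⟩ := mem_closure_iff.1 hyV R' hR'.isOpen hyR
    exact (hVR hzV).2 (subset_closure hzR)
  refine Finite.of_finite_image (f := fun R => {C ∈ 𝒱 | (C ∩ R).Nonempty})
    (hfin.finite_subsets.subset ?_) ?_
  · rintro _ ⟨R, -, rfl⟩
    exact sep_subset _ _
  · intro R hR R' hR' he
    exact (hle R R' hR hR' he.subset).antisymm (hle R' R hR' hR he.superset)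

lemma SgCompact.of_deltaOpen {X : Type*} [TopologicalSpace X] (h : SgCompact X) {A : Set X}
    (hA : DeltaOpen A) : SgCompact A := by
  intro 𝒰 h𝒰 hcov
  have hAo := hA.isOpen
  obtain ⟨𝒞, h𝒞, hA𝒞⟩ := hA
  have h𝒞fin : 𝒞.Finite := h.finite_setOf_regularOpen.subset h𝒞
  have hR : ∀ R ∈ 𝒞, ∃ 𝒢 ⊆ 𝒰, 𝒢.Finite ∧ R ⊆ ⋃₀ (image Subtype.val '' 𝒢) := by
    intro R hR
    obtain ⟨ℱ, hℱ, hfin, hu⟩ := h.finite_subcover_regularOpen (h𝒞 R hR)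
      (𝒲 := image Subtype.val '' 𝒰)
      (by
        rintro _ ⟨U, hU, rfl⟩
        exact (h𝒰 U hU).image_val hAo)
      (by
        intro x hx
        have hxA : x ∈ A := hA𝒞 ▸ ⟨R, hR, hx⟩
        obtain ⟨U, hU, hxU⟩ := (hcov ▸ mem_univ (⟨x, hxA⟩ : A) : (⟨x, hxA⟩ : A) ∈ ⋃₀ 𝒰)
        exact ⟨_, ⟨U, hU, rfl⟩, ⟨x, hxA⟩, hxU, rfl⟩)
    obtain ⟨𝒢, h𝒢, h𝒢fin, hu𝒢⟩ := exists_subset_image_finite_and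
      (p := fun 𝒯 => R ⊆ ⋃₀ 𝒯) |>.1 ⟨ℱ, hℱ, hfin, hu⟩
    exact ⟨𝒢, h𝒢, h𝒢fin, hu𝒢⟩
  choose! 𝒢 h𝒢 h𝒢fin hcovR using hR
  refine ⟨⋃ R ∈ 𝒞, 𝒢 R, iUnion₂_subset h𝒢, h𝒞fin.biUnion h𝒢fin, ?_⟩
  rw [eq_univ_iff_forall]
  rintro ⟨x, hxA⟩
  obtain ⟨R, hR, hxR⟩ := (hA𝒞 ▸ hxA : x ∈ ⋃₀ 𝒞)
  obtain ⟨_, ⟨U, hU, rfl⟩, ⟨y, hyU, rfl⟩⟩ := hcovR R hR hxR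
  exact ⟨U, mem_biUnion hR hU, hyU⟩

/-- Every δ-open subset of an sg-compact space is sg-compact
(with the subspace topology); in particular sg-compactness is hereditary with
respect to regular open sets. -/
theorem stmt_10 {X : Type*} [TopologicalSpace X] (h : SgCompact X) :
    (∀ A : Set X, DeltaOpen A → SgCompact A) ∧
    (∀ R : Set X, RegularOpen R → SgCompact R) :=
  ⟨fun _ hA => h.of_deltaOpen hA, fun _ hR => h.of_deltaOpen hR.deltaOpen⟩
end

section
/- Let f : (X,τ) → (Y,σ) be a pre-sg-continuous surjection. If (X,τ) is sg-compact, then (Y,σ) is semi-compact. -/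
open Set TopologicalSpace

/-- The complement of a semi-open set is semi-closed. -/
theorem SemiOpen.semiClosed_compl {X : Type*} [TopologicalSpace X] {A : Set X}
    (hA : SemiOpen A) : SemiClosed Aᶜ := by
  rw [SemiClosed, closure_compl, interior_compl]
  exact compl_subset_compl.mpr hA

/-- A pre-sg-continuous surjective image of an sg-compact space
is semi-compact. -/
theorem stmt_12 {X Y : Type*} [TopologicalSpace X] [TopologicalSpace Y]
    (f : X → Y) (hf : Function.Surjective f)
    (hc : ∀ F : Set Y, SemiClosed F → SgClosed (f ⁻¹' F))
    (h : SgCompact X) : SemiCompact Y := by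
  intro 𝒰 h𝒰 hcov
  have hopen : ∀ V ∈ preimage f '' 𝒰, SgOpen V := by
    rintro _ ⟨U, hU, rfl⟩
    rw [SgOpen, ← preimage_compl]
    exact hc _ (h𝒰 U hU).semiClosed_compl
  have hcov' : ⋃₀ (preimage f '' 𝒰) = univ := by
    rw [sUnion_image, ← preimage_sUnion, hcov, preimage_univ]
  obtain ⟨𝒢, h𝒢, hfin, hcov𝒢⟩ := exists_subset_image_finite_and.mp (h _ hopen hcov')
  refine ⟨𝒢, h𝒢, hfin, ?_⟩
  rw [sUnion_image, ← preimage_sUnion] at hcov𝒢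
  exact hf.preimage_injective (hcov𝒢.trans preimage_univ.symm)
end

section
/- Every infinite set endowed with the cofinite topology is sg-compact; moreover, every subspace of such a space is sg-compact (it is hereditarily sg-compact). -/
open Set TopologicalSpace

/-- In a space with the cofinite topology, the complement of a nonempty sg-open set is finite. -/
theorem SgOpen.finite_compl {X : Type*} [TopologicalSpace X]
    (ht : ∀ s : Set X, IsOpen s ↔ s = ∅ ∨ sᶜ.Finite) {A : Set X} (hA : SgOpen A)
    (hne : A.Nonempty) : Aᶜ.Finite := by
  by_contra hinf
  obtain ⟨x, hx⟩ := hne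
  have hopen : IsOpen ({x}ᶜ : Set X) := (ht _).2 (Or.inr (by simp))
  have hsub : Aᶜ ⊆ ({x}ᶜ : Set X) := by
    intro y hy hyx
    exact hy (mem_singleton_iff.1 hyx ▸ hx)
  have hsemi : SemiOpen ({x}ᶜ : Set X) := by
    rw [SemiOpen, hopen.interior_eq]
    exact subset_closure
  refine hA _ hsemi hsub (a := x) ?_ rfl
  rintro B ⟨hB, hAB⟩
  have hcl : closure B = univ := by
    rcases (ht _).1 (isClosed_closure (s := B)).isOpen_compl with h | h
    · exact compl_empty_iff.1 h
    · rw [compl_compl] at h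
      exact absurd (h.subset (hAB.trans subset_closure)) hinf
  apply hB
  simp [hcl]

theorem sgCompact_of_isOpen_iff {X : Type*} [TopologicalSpace X]
    (ht : ∀ s : Set X, IsOpen s ↔ s = ∅ ∨ sᶜ.Finite) : SgCompact X := by
  intro 𝒰 h𝒰 hcov
  have hmem : ∀ x : X, ∃ U ∈ 𝒰, x ∈ U := fun x => mem_sUnion.1 (hcov ▸ mem_univ x)
  choose f hf𝒰 hf using hmem
  rcases isEmpty_or_nonempty X with hX | ⟨⟨a⟩⟩
  · exact ⟨∅, empty_subset _, finite_empty, Subsingleton.elim _ _⟩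
  · have hfin := (h𝒰 _ (hf𝒰 a)).finite_compl ht ⟨a, hf a⟩
    refine ⟨insert (f a) (f '' (f a)ᶜ), ?_, (hfin.image f).insert _, ?_⟩
    · rintro _ (rfl | ⟨x, -, rfl⟩)
      exacts [hf𝒰 a, hf𝒰 x]
    · refine eq_univ_of_forall fun x => ?_
      by_cases hx : x ∈ f a
      · exact ⟨f a, mem_insert _ _, hx⟩
      · exact ⟨f x, mem_insert_of_mem _ ⟨x, hx, rfl⟩, hf x⟩

/-- A subspace of a space with the cofinite topology has the cofinite topology. -/
theorem isOpen_subtype_iff_of_isOpen_iff {X : Type*} [TopologicalSpace X]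
    (ht : ∀ s : Set X, IsOpen s ↔ s = ∅ ∨ sᶜ.Finite) (B : Set X) (s : Set B) :
    IsOpen s ↔ s = ∅ ∨ sᶜ.Finite := by
  constructor
  · rintro ⟨t, ht', rfl⟩
    rcases (ht t).1 ht' with rfl | h
    · exact Or.inl rfl
    · exact Or.inr (h.preimage Subtype.val_injective.injOn)
  · rintro (rfl | h)
    · exact isOpen_empty
    · refine ⟨(Subtype.val '' sᶜ)ᶜ, (ht _).2 (Or.inr ?_), ?_⟩
      · rw [compl_compl]
        exact h.image _
      · rw [preimage_compl, preimage_image_eq _ Subtype.val_injective, compl_compl]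

/-- An infinite set with the cofinite topology is sg-compact,
and moreover every subspace of it is sg-compact (it is hereditarily sg-compact). -/
theorem stmt_14 {X : Type*} [Infinite X] [TopologicalSpace X]
    (ht : ∀ s : Set X, IsOpen s ↔ s = ∅ ∨ sᶜ.Finite) :
    SgCompact X ∧ ∀ B : Set X, SgCompact B := by
  exact ⟨sgCompact_of_isOpen_iff ht, fun B =>
    sgCompact_of_isOpen_iff (isOpen_subtype_iff_of_isOpen_iff ht B)⟩
end

section
/- Let A be an infinite set, p ∉ A, X = A ∪ {p}, and let τ = {∅, A, X}. Then (X,τ) is a C₃-space, and hence sg-compact. -/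
open Set TopologicalSpace

/-- If every nonempty open set contains the open set `A`, and `A ≠ univ`, then `A` has no nonempty
sg-closed subset: such a subset is dense, so its semi-closure is the whole space. -/
theorem SgClosed.eq_empty_of_subset {X : Type*} [TopologicalSpace X] {A B : Set X}
    (hA : IsOpen A) (hA_ne : A ≠ univ) (hmin : ∀ s : Set X, IsOpen s → s.Nonempty → A ⊆ s)
    (hB : SgClosed B) (hBA : B ⊆ A) : B = ∅ := by
  by_contra hne
  obtain ⟨b, hb⟩ := nonempty_iff_ne_empty.mpr hne
  have hsemi : SemiOpen A := by
    unfold SemiOpen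
    rw [hA.interior_eq]
    exact subset_closure
  refine hA_ne (univ_subset_iff.mp (Subset.trans ?_ (hB A hsemi hBA)))
  rintro x - C ⟨hC, hBC⟩
  have hdense : closure C = univ := by
    rw [← compl_empty_iff, ← not_nonempty_iff_eq_empty]
    exact fun h => hmin _ isClosed_closure.isOpen_compl h (hBA hb) (subset_closure (hBC hb))
  exact hC (by simp [hdense])

/-- For `X = A ∪ {p}` with `A` infinite, `p ∉ A` and topology
`{∅, A, X}`, the space `X` is a C₃-space, hence sg-compact. -/
theorem stmt_15 {X : Type*} [TopologicalSpace X] (A : Set X) (p : X)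
    (hp : p ∉ A) (hA : A.Infinite) (hU : A ∪ {p} = univ)
    (ht : ∀ s : Set X, IsOpen s ↔ s = ∅ ∨ s = A ∨ s = univ) :
    C3Space X ∧ SgCompact X := by
  have hAo : IsOpen A := (ht A).mpr (Or.inr (Or.inl rfl))
  have hA_ne : A ≠ univ := fun h => hp (h ▸ mem_univ p)
  have hmin : ∀ s : Set X, IsOpen s → s.Nonempty → A ⊆ s := by
    intro s hs hne
    rcases (ht s).mp hs with rfl | rfl | rfl
    · exact absurd hne not_nonempty_empty
    · exact Subset.rfl
    · exact subset_univ _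
  have hmem : ∀ x, x ≠ p → x ∈ A := fun x hx =>
    (hU.symm ▸ mem_univ x : x ∈ A ∪ {p}).resolve_right hx
  have hempty : ∀ B : Set X, SgClosed B → p ∉ B → B = ∅ := fun B hB hpB =>
    hB.eq_empty_of_subset hAo hA_ne hmin fun x hx => hmem x fun h => hpB (h ▸ hx)
  constructor
  · intro B hB
    have hdiff : B \ {p} = ∅ := hempty _ (hB _ sdiff_subset) (by simp)
    exact (finite_singleton p).subset (sdiff_eq_empty.mp hdiff)
  · intro 𝒰 hsg hcover
    obtain ⟨U, hU_mem, hpU⟩ : p ∈ ⋃₀ 𝒰 := hcover ▸ mem_univ p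
    have hU_univ : U = univ := compl_empty_iff.mp (hempty _ (hsg U hU_mem) (by simpa using hpU))
    exact ⟨{U}, by simpa using hU_mem, finite_singleton U, by simp [hU_univ]⟩
end

section
/- In any topological space (X,τ), every nowhere dense subset is hereditarily sg-closed. -/
open Set TopologicalSpace

/-- Every nowhere dense subset is hereditarily sg-closed. -/
theorem stmt_19 {X : Type*} [TopologicalSpace X] (A : Set X)
    (hA : interior (closure A) = ∅) : HSgClosed A := by
  intro B hBA U _ hBU
  have hB : interior (closure B) = ∅ :=
    subset_empty_iff.mp ((interior_mono (closure_mono hBA)).trans hA.subset)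
  have hB' : SemiClosed B := hB.subset.trans (empty_subset B)
  exact fun x hx => hBU (hx B ⟨hB', Subset.rfl⟩)
end
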